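/- Let χ ≥ 2 be an integer. Define ν₊(k) := k(k+1)/2 and ν₋(k) := k(k−1)/2 for positive integers k; the column vectors a := (1,0)ᵀ and t := (1,1)ᵀ in ℝ²; the 2×4 matrix S with rows (1,0,0,1) and (0,1,1,0); for positive integers χ₁, χ₂ the 4×2 matrix J(χ₁,χ₂) whose first column is ( ν₊(χ₁)ν₊(χ₂)/ν₊(χ₁χ₂), 0, 0, ν₋(χ₁)ν₋(χ₂)/ν₊(χ₁χ₂) )ᵀ and whose second column is ( 0, ν₊(χ₁)ν₋(χ₂)/ν₋(χ₁χ₂), ν₋(χ₁)ν₊(χ₂)/ν₋(χ₁χ₂), 0 )ᵀ; G := J(χ,χ)·S (4×4); and the 8×8 three-site matrix G₃ := ( 1₂ ⊗ J(χ,χ) ) · ( J(χ,χ²) · S ) · ( 1₂ ⊗ S ). Define the 4×4 matrices E_R := ( tᵀ ⊗ tᵀ ⊗ tᵀ ⊗ 1₄ ⊗ tᵀ ) · ( 1₄ ⊗ G ⊗ 1₄ ) · ( G₃ ⊗ G₃ ) · ( 1₂ ⊗ a ⊗ a ⊗ 1₂ ⊗ a ⊗ a ), E_C := ( tᵀ ⊗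 tᵀ ⊗ 1₄ ⊗ tᵀ ⊗ tᵀ ) · ( G₃ ⊗ G₃ ) · ( 1₂ ⊗ a ⊗ a ⊗ 1₂ ⊗ a ⊗ a ), and E_L := ( tᵀ ⊗ 1₄ ⊗ tᵀ ⊗ tᵀ ⊗ tᵀ ) · ( 1₄ ⊗ G ⊗ 1₄ ) · ( G₃ ⊗ G₃ ) · ( 1₂ ⊗ a ⊗ a ⊗ 1₂ ⊗ a ⊗ a ), where the tensor factors are ordered as the six doubled sites (c₁, a₁, b₁, c₂, a₂, b₂) and the middle factor 1₄ ⊗ G ⊗ 1₄ applies G to the pair (b₁, c₂). Then the average E := (E_L + E_C + E_R)/3 has eigenvalues (with multiplicity) 1, η_ter, λ₃, λ₄, where η_ter := χ²(1 + 8χ² + χ⁴ + √(1 + 4χ² + 54χ⁴ + 4χ⁶ + χ⁸)) / (6(1 + χ² + χ⁴)²), λ₃ := χ²/(3(1 + χ² + χ⁴)), and λ₄ := χ²(1 + 8χ² + χ⁴ − √(1 + 4χ² + 54χ⁴ + 4χ⁶ + χ⁸)) / (6(1 + χ² + χ⁴)²). In particular the unique largest eigenvalue is 1 and the second largest eigenvalue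 is η_ter. -/

import Mathlib

open Matrix Polynomial

namespace MERAter

/-- `ν₊(k) = k(k+1)/2`. -/
noncomputable def nup (k : ℕ) : ℝ := (k : ℝ) * ((k : ℝ) + 1) / 2

/-- `ν₋(k) = k(k−1)/2`. -/
noncomputable def num (k : ℕ) : ℝ := (k : ℝ) * ((k : ℝ) - 1) / 2

/-- The vector `a = (1,0)ᵀ`. -/
noncomputable def avec : Fin 2 → ℝ := ![1, 0]

/-- The vector `t = (1,1)ᵀ`. -/
noncomputable def tvec : Fin 2 → ℝ := ![1, 1]

/-- The `2×4` matrix `S` with rows `(1,0,0,1)` and `(0,1,1,0)`; columns indexed by pairs in the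
order `(+,+), (+,−), (−,+), (−,−)`. -/
noncomputable def Smat : Matrix (Fin 2) (Fin 2 × Fin 2) ℝ :=
  fun r c => if (r = 0 ∧ c.1 = c.2) ∨ (r = 1 ∧ c.1 ≠ c.2) then 1 else 0

/-- The `4×2` matrix `J(χ₁,χ₂)`; rows indexed by pairs in the order
`(+,+), (+,−), (−,+), (−,−)`. -/
noncomputable def Jmat (χ₁ χ₂ : ℕ) : Matrix (Fin 2 × Fin 2) (Fin 2) ℝ :=
  fun r c =>
    if c = 0 then
      if r = ((0 : Fin 2), (0 : Fin 2)) then nup χ₁ * nup χ₂ / nup (χ₁ * χ₂)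
      else if r = ((1 : Fin 2), (1 : Fin 2)) then num χ₁ * num χ₂ / nup (χ₁ * χ₂)
      else 0
    else
      if r = ((0 : Fin 2), (1 : Fin 2)) then nup χ₁ * num χ₂ / num (χ₁ * χ₂)
      else if r = ((1 : Fin 2), (0 : Fin 2)) then num χ₁ * nup χ₂ / num (χ₁ * χ₂)
      else 0

/-- `G = J(χ,χ) · S`: the doubled fully depolarizing channel on two doubled sites. -/
noncomputable def Gmat (χ : ℕ) : Matrix (Fin 2 × Fin 2) (Fin 2 × Fin 2) ℝ :=
  Jmat χ χ * Smat

/-- `1₂ ⊗ J(χ,χ)` as an `8×4` matrix. -/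
noncomputable def oneJ (χ : ℕ) : Matrix (Fin 2 × Fin 2 × Fin 2) (Fin 2 × Fin 2) ℝ :=
  fun r c => (if r.1 = c.1 then 1 else 0) * Jmat χ χ (r.2.1, r.2.2) c.2

/-- `1₂ ⊗ S` as a `4×8` matrix. -/
noncomputable def oneS : Matrix (Fin 2 × Fin 2) (Fin 2 × Fin 2 × Fin 2) ℝ :=
  fun r c => (if r.1 = c.1 then 1 else 0) * Smat r.2 (c.2.1, c.2.2)

/-- The three-site channel `G₃ = (1₂ ⊗ J(χ,χ)) · (J(χ,χ²) · S) · (1₂ ⊗ S)`. -/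
noncomputable def G3 (χ : ℕ) : Matrix (Fin 2 × Fin 2 × Fin 2) (Fin 2 × Fin 2 × Fin 2) ℝ :=
  oneJ χ * (Jmat χ (χ ^ 2) * Smat) * oneS

/-- The six-site space `(c₁,a₁,b₁,c₂,a₂,b₂)`. -/
abbrev V6 : Type := Fin 2 × Fin 2 × Fin 2 × Fin 2 × Fin 2 × Fin 2

/-- `1₂ ⊗ a ⊗ a ⊗ 1₂ ⊗ a ⊗ a`: appending the auxiliary sites `a₁, b₁, a₂, b₂`. -/
noncomputable def appendAux : Matrix V6 (Fin 2 × Fin 2) ℝ :=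
  fun v x =>
    (if v.1 = x.1 then 1 else 0) * avec v.2.1 * avec v.2.2.1 *
      (if v.2.2.2.1 = x.2 then 1 else 0) * avec v.2.2.2.2.1 * avec v.2.2.2.2.2

/-- `G₃ ⊗ G₃`: the isometry layer. -/
noncomputable def isoLayer (χ : ℕ) : Matrix V6 V6 ℝ :=
  fun v w =>
    G3 χ (v.1, v.2.1, v.2.2.1) (w.1, w.2.1, w.2.2.1) *
      G3 χ (v.2.2.2.1, v.2.2.2.2.1, v.2.2.2.2.2) (w.2.2.2.1, w.2.2.2.2.1, w.2.2.2.2.2)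

/-- `1₄ ⊗ G_{b₁,c₂} ⊗ 1₄`: the disentangler layer. -/
noncomputable def disLayer (χ : ℕ) : Matrix V6 V6 ℝ :=
  fun v w =>
    (if v.1 = w.1 then 1 else 0) * (if v.2.1 = w.2.1 then 1 else 0) *
      Gmat χ (v.2.2.1, v.2.2.2.1) (w.2.2.1, w.2.2.2.1) *
      (if v.2.2.2.2.1 = w.2.2.2.2.1 then 1 else 0) *
      (if v.2.2.2.2.2 = w.2.2.2.2.2 then 1 else 0)

/-- `tᵀ ⊗ tᵀ ⊗ tᵀ ⊗ 1₄ ⊗ tᵀ`: trace out `c₁, a₁, b₁, b₂`, keeping `(c₂,a₂)`. -/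
noncomputable def traceR : Matrix (Fin 2 × Fin 2) V6 ℝ :=
  fun x v =>
    tvec v.1 * tvec v.2.1 * tvec v.2.2.1 *
      (if x.1 = v.2.2.2.1 then 1 else 0) * (if x.2 = v.2.2.2.2.1 then 1 else 0) *
      tvec v.2.2.2.2.2

/-- `tᵀ ⊗ tᵀ ⊗ 1₄ ⊗ tᵀ ⊗ tᵀ`: trace out `c₁, a₁, a₂, b₂`, keeping `(b₁,c₂)`. -/
noncomputable def traceC : Matrix (Fin 2 × Fin 2) V6 ℝ :=
  fun x v =>
    tvec v.1 * tvec v.2.1 *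
      (if x.1 = v.2.2.1 then 1 else 0) * (if x.2 = v.2.2.2.1 then 1 else 0) *
      tvec v.2.2.2.2.1 * tvec v.2.2.2.2.2

/-- `tᵀ ⊗ 1₄ ⊗ tᵀ ⊗ tᵀ ⊗ tᵀ`: trace out `c₁, c₂, a₂, b₂`, keeping `(a₁,b₁)`. -/
noncomputable def traceL : Matrix (Fin 2 × Fin 2) V6 ℝ :=
  fun x v =>
    tvec v.1 *
      (if x.1 = v.2.1 then 1 else 0) * (if x.2 = v.2.2.1 then 1 else 0) *
      tvec v.2.2.2.1 * tvec v.2.2.2.2.1 * tvec v.2.2.2.2.2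

/-- Right-moving doubled layer-transition matrix of the ternary 1D MERA. -/
noncomputable def ER (χ : ℕ) : Matrix (Fin 2 × Fin 2) (Fin 2 × Fin 2) ℝ :=
  traceR * disLayer χ * isoLayer χ * appendAux

/-- Central doubled layer-transition matrix of the ternary 1D MERA. -/
noncomputable def EC (χ : ℕ) : Matrix (Fin 2 × Fin 2) (Fin 2 × Fin 2) ℝ :=
  traceC * disLayer χ * isoLayer χ * appendAux

/-- Left-moving doubled layer-transition matrix of the ternary 1D MERA. -/
noncomputable def EL (χ : ℕ) : Matrix (Fin 2 × Fin 2) (Fin 2 × Fin 2) ℝ :=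
  traceL * disLayer χ * isoLayer χ * appendAux

/-- The spatially averaged doubled layer-transition matrix `E = (E_L + E_C + E_R)/3`. -/
noncomputable def Eavg (χ : ℕ) : Matrix (Fin 2 × Fin 2) (Fin 2 × Fin 2) ℝ :=
  (1 / 3 : ℝ) • (EL χ + EC χ + ER χ)

/-- The second largest eigenvalue
`η_ter = χ²(1 + 8χ² + χ⁴ + √(1 + 4χ² + 54χ⁴ + 4χ⁶ + χ⁸)) / (6(1 + χ² + χ⁴)²)`. -/
noncomputable def etaTer (χ : ℕ) : ℝ :=
  (χ : ℝ) ^ 2 * (1 + 8 * (χ : ℝ) ^ 2 + (χ : ℝ) ^ 4 +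
      Real.sqrt (1 + 4 * (χ : ℝ) ^ 2 + 54 * (χ : ℝ) ^ 4 + 4 * (χ : ℝ) ^ 6 + (χ : ℝ) ^ 8)) /
    (6 * (1 + (χ : ℝ) ^ 2 + (χ : ℝ) ^ 4) ^ 2)

/-- `λ₃ = χ²/(3(1 + χ² + χ⁴))`. -/
noncomputable def lam3Ter (χ : ℕ) : ℝ :=
  (χ : ℝ) ^ 2 / (3 * (1 + (χ : ℝ) ^ 2 + (χ : ℝ) ^ 4))

/-- The fourth eigenvalue
`λ₄ = χ²(1 + 8χ² + χ⁴ − √(1 + 4χ² + 54χ⁴ + 4χ⁶ + χ⁸)) / (6(1 + χ² + χ⁴)²)`. -/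
noncomputable def lam4Ter (χ : ℕ) : ℝ :=
  (χ : ℝ) ^ 2 * (1 + 8 * (χ : ℝ) ^ 2 + (χ : ℝ) ^ 4 -
      Real.sqrt (1 + 4 * (χ : ℝ) ^ 2 + 54 * (χ : ℝ) ^ 4 + 4 * (χ : ℝ) ^ 6 + (χ : ℝ) ^ 8)) /
    (6 * (1 + (χ : ℝ) ^ 2 + (χ : ℝ) ^ 4) ^ 2)

lemma tvec_apply (i : Fin 2) : tvec i = 1 := by
  fin_cases i <;> rfl

lemma avec_apply (i : Fin 2) : avec i = if i = 0 then 1 else 0 := by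
  fin_cases i <;> rfl

lemma Smat_apply (r : Fin 2) (c : Fin 2 × Fin 2) :
    Smat r c = if r = c.1 + c.2 then 1 else 0 := by
  obtain ⟨b, c⟩ := c
  fin_cases r <;> fin_cases b <;> fin_cases c <;> simp [Smat]

lemma mul_Smat_apply {ι : Type*} (M : Matrix ι (Fin 2) ℝ) (r : ι) (c : Fin 2 × Fin 2) :
    (M * Smat) r c = M r (c.1 + c.2) := by
  simp [Matrix.mul_apply, Smat_apply]

lemma Gmat_apply (χ : ℕ) (r c : Fin 2 × Fin 2) : Gmat χ r c = Jmat χ χ r (c.1 + c.2) :=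
  mul_Smat_apply _ _ _

lemma mul_oneS_apply {ι : Type*} (M : Matrix ι (Fin 2 × Fin 2) ℝ) (r : ι) (w y z : Fin 2) :
    (M * oneS) r (w, y, z) = M r (w, y + z) := by
  simp [Matrix.mul_apply, oneS, Smat_apply, Fintype.sum_prod_type_right]

lemma mul_appendAux_apply {ι : Type*} (M : Matrix ι V6 ℝ) (v : ι) (y : Fin 2 × Fin 2) :
    (M * appendAux) v y = M v (y.1, 0, 0, y.2, 0, 0) := by
  rw [Matrix.mul_apply, Finset.sum_eq_single (y.1, 0, 0, y.2, 0, 0)]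
  · simp [appendAux, avec_apply]
  · rintro ⟨c₁, a₁, b₁, c₂, a₂, b₂⟩ - hne
    simp only [appendAux, avec_apply, mul_ite, mul_one, mul_zero]
    split_ifs <;> simp_all
  · simp

/-- The components of `G₃` applied to a coarse site in the basis state `w` with two appended
auxiliary sites. -/
noncomputable def isoOut (χ : ℕ) (w x y z : Fin 2) : ℝ :=
  G3 χ (x, y, z) (w, 0, 0)

lemma isoOut_eq_sum (χ : ℕ) (w x y z : Fin 2) :
    isoOut χ w x y z = ∑ m, Jmat χ (χ ^ 2) (x, m) w * Jmat χ χ (y, z) m := by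
  rw [isoOut, G3, mul_oneS_apply, Matrix.mul_apply]
  simp [mul_Smat_apply, oneJ, Fintype.sum_prod_type_right, mul_comm]

lemma isoLayer_mul_appendAux_apply (χ : ℕ) (c₁ a₁ b₁ c₂ a₂ b₂ : Fin 2) (y : Fin 2 × Fin 2) :
    (isoLayer χ * appendAux) (c₁, a₁, b₁, c₂, a₂, b₂) y =
      isoOut χ y.1 c₁ a₁ b₁ * isoOut χ y.2 c₂ a₂ b₂ := by
  rw [mul_appendAux_apply]
  rfl

lemma traceR_mul_disLayer_apply (χ : ℕ) (x : Fin 2 × Fin 2) (c₁ a₁ b₁ c₂ a₂ b₂ : Fin 2) :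
    (traceR * disLayer χ) x (c₁, a₁, b₁, c₂, a₂, b₂) =
      (∑ β, Jmat χ χ (β, x.1) (b₁ + c₂)) * if x.2 = a₂ then 1 else 0 := by
  simp [Matrix.mul_apply, traceR, disLayer, Gmat_apply, tvec_apply,
    Fintype.sum_prod_type]

lemma traceC_mul_disLayer_apply (χ : ℕ) (x : Fin 2 × Fin 2) (c₁ a₁ b₁ c₂ a₂ b₂ : Fin 2) :
    (traceC * disLayer χ) x (c₁, a₁, b₁, c₂, a₂, b₂) = Jmat χ χ x (b₁ + c₂) := by
  simp [Matrix.mul_apply, traceC, disLayer, Gmat_apply, tvec_apply,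
    Fintype.sum_prod_type]

lemma traceL_mul_disLayer_apply (χ : ℕ) (x : Fin 2 × Fin 2) (c₁ a₁ b₁ c₂ a₂ b₂ : Fin 2) :
    (traceL * disLayer χ) x (c₁, a₁, b₁, c₂, a₂, b₂) =
      (∑ γ, Jmat χ χ (x.2, γ) (b₁ + c₂)) * if x.1 = a₁ then 1 else 0 := by
  simp [Matrix.mul_apply, traceL, disLayer, Gmat_apply, tvec_apply,
    Fintype.sum_prod_type]

lemma ER_apply (χ : ℕ) (x y : Fin 2 × Fin 2) :
    ER χ x y = ∑ b, ∑ c, (∑ β, Jmat χ χ (β, x.1) (b + c)) *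
      (∑ i, ∑ j, isoOut χ y.1 i j b) * (∑ k, isoOut χ y.2 c x.2 k) := by
  rw [ER, Matrix.mul_assoc, Matrix.mul_apply]
  simp only [Fintype.sum_prod_type, traceR_mul_disLayer_apply, isoLayer_mul_appendAux_apply]
  obtain ⟨x₁, x₂⟩ := x
  fin_cases x₂ <;> simp [Fin.sum_univ_two] <;> ring

lemma EC_apply (χ : ℕ) (x y : Fin 2 × Fin 2) :
    EC χ x y = ∑ b, ∑ c, Jmat χ χ x (b + c) *
      (∑ i, ∑ j, isoOut χ y.1 i j b) * (∑ j, ∑ k, isoOut χ y.2 c j k) := by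
  rw [EC, Matrix.mul_assoc, Matrix.mul_apply]
  simp only [Fintype.sum_prod_type, traceC_mul_disLayer_apply, isoLayer_mul_appendAux_apply]
  simp [Fin.sum_univ_two]
  ring

lemma EL_apply (χ : ℕ) (x y : Fin 2 × Fin 2) :
    EL χ x y = ∑ b, ∑ c, (∑ γ, Jmat χ χ (x.2, γ) (b + c)) *
      (∑ i, isoOut χ y.1 i x.1 b) * (∑ j, ∑ k, isoOut χ y.2 c j k) := by
  rw [EL, Matrix.mul_assoc, Matrix.mul_apply]
  simp only [Fintype.sum_prod_type, traceL_mul_disLayer_apply, isoLayer_mul_appendAux_apply]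
  obtain ⟨x₁, x₂⟩ := x
  fin_cases x₁ <;> simp [Fin.sum_univ_two] <;> ring

lemma Jmat_self_apply {χ : ℕ} (hχ : 2 ≤ χ) (x y m : Fin 2) :
    Jmat χ χ (x, y) m = if x + y ≠ m then 0 else if m = 1 then 1 / 2 else
      if x = 0 then ((χ : ℝ) + 1) ^ 2 / (2 * ((χ : ℝ) ^ 2 + 1))
        else ((χ : ℝ) - 1) ^ 2 / (2 * ((χ : ℝ) ^ 2 + 1)) := by
  have h : (2 : ℝ) ≤ χ := by exact_mod_cast hχ
  have h0 : (χ : ℝ) ≠ 0 := by linarith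
  have h1 : (χ : ℝ) ^ 2 - 1 ≠ 0 := by nlinarith
  have h2 : (χ : ℝ) ^ 2 + 1 ≠ 0 := by nlinarith
  fin_cases x <;> fin_cases y <;> fin_cases m <;> simp [Jmat, nup, num] <;> field_simp <;> ring

lemma isoOut_apply {χ : ℕ} (hχ : 2 ≤ χ) (w x y z : Fin 2) :
    isoOut χ w x y z = if x + y + z ≠ w then 0 else
      (if x = w ∧ y = w ∧ z = w then (χ + (1 - 2 * (w : ℝ))) ^ 2
        else (χ - (1 - 2 * (w : ℝ))) ^ 2) / (4 * ((χ : ℝ) ^ 2 - (1 - 2 * (w : ℝ)) * χ + 1)) := by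
  have h : (2 : ℝ) ≤ χ := by exact_mod_cast hχ
  have h0 : (χ : ℝ) ≠ 0 := by linarith
  have h1 : (χ : ℝ) ^ 2 - 1 ≠ 0 := by nlinarith
  have h2 : (χ : ℝ) ^ 2 + 1 ≠ 0 := by nlinarith
  have hu : (χ : ℝ) ^ 2 - χ + 1 ≠ 0 := by nlinarith
  have hu' : (χ : ℝ) * (χ - 1) + 1 ≠ 0 := by nlinarith
  have hv : (χ : ℝ) ^ 2 + χ + 1 ≠ 0 := by nlinarith
  have h3 : (χ : ℝ) ^ 3 - 1 ≠ 0 := by nlinarith [sq_nonneg (χ : ℝ)]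
  have h4 : (χ : ℝ) ^ 3 + 1 ≠ 0 := by positivity
  have h11 : (1 : Fin 2) + 1 = 0 := rfl
  rw [isoOut_eq_sum, Fin.sum_univ_two]
  simp only [Jmat_self_apply hχ]
  fin_cases w <;> fin_cases x <;> fin_cases y <;> fin_cases z <;>
    norm_num [Jmat, nup, num, h11] <;> field_simp <;> ring

/-- The swap-antisymmetric vector contributes the eigenvalue `l`, the common column sum the
eigenvalue `1`, and the symmetric vectors of coordinate sum zero the eigenvalues `e` and `m`. -/
lemma charpoly_of_swap_of_sum {M : Matrix (Fin 2 × Fin 2) (Fin 2 × Fin 2) ℝ}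
    (hswap : ∀ x y, M x.swap y.swap = M x y) (hsum : ∀ y, ∑ x, M x y = 1) {l e m : ℝ}
    (hl : M (0, 1) (0, 1) - M (0, 1) (1, 0) = l)
    (htr : M (0, 0) (0, 0) - M (0, 0) (1, 1)
      + (M (0, 1) (0, 1) + M (0, 1) (1, 0) - 2 * M (0, 1) (1, 1)) = e + m)
    (hdet : (M (0, 0) (0, 0) - M (0, 0) (1, 1))
        * (M (0, 1) (0, 1) + M (0, 1) (1, 0) - 2 * M (0, 1) (1, 1))
      - 2 * (M (0, 0) (0, 1) - M (0, 0) (1, 1)) * (M (0, 1) (0, 0) - M (0, 1) (1, 1)) = e * m) :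
    M.charpoly = (X - C 1) * (X - C e) * (X - C l) * (X - C m) := by
  have s1 := hswap (0, 1) (0, 0)
  have s2 := hswap (0, 0) (0, 1)
  have s3 := hswap (0, 1) (0, 1)
  have s4 := hswap (0, 1) (1, 0)
  have s5 := hswap (0, 1) (1, 1)
  have t1 := hsum (0, 0)
  have t2 := hsum (0, 1)
  have t3 := hsum (1, 0)
  have t4 := hsum (1, 1)
  simp only [Fintype.sum_prod_type, Fin.sum_univ_two, Prod.swap_prod_mk]
    at s1 s2 s3 s4 s5 t1 t2 t3 t4
  refine Polynomial.funext fun r => ?_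
  rw [Matrix.eval_charpoly, ← Matrix.det_submatrix_equiv_self finProdFinEquiv.symm]
  have hM : (Matrix.scalar (Fin 2 × Fin 2) r - M).submatrix
      (finProdFinEquiv (m := 2) (n := 2)).symm finProdFinEquiv.symm =
      !![r - M (0, 0) (0, 0), -M (0, 0) (0, 1), -M (0, 0) (1, 0), -M (0, 0) (1, 1);
        -M (0, 1) (0, 0), r - M (0, 1) (0, 1), -M (0, 1) (1, 0), -M (0, 1) (1, 1);
        -M (1, 0) (0, 0), -M (1, 0) (0, 1), r - M (1, 0) (1, 0), -M (1, 0) (1, 1);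
        -M (1, 1) (0, 0), -M (1, 1) (0, 1), -M (1, 1) (1, 0), r - M (1, 1) (1, 1)] := by
    ext i j
    fin_cases i <;> fin_cases j <;> simp [finProdFinEquiv, Fin.divNat, Fin.modNat]
  rw [hM]
  have u1 : M (1, 1) (0, 0) = 1 - M (0, 0) (0, 0) - 2 * M (0, 1) (0, 0) := by linarith
  have u2 : M (1, 1) (0, 1) = 1 - M (0, 0) (0, 1) - M (0, 1) (0, 1) - M (0, 1) (1, 0) := by
    linarith
  have u3 : M (1, 1) (1, 0) = 1 - M (0, 0) (0, 1) - M (0, 1) (0, 1) - M (0, 1) (1, 0) := by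
    linarith
  have u4 : M (1, 1) (1, 1) = 1 - M (0, 0) (1, 1) - 2 * M (0, 1) (1, 1) := by linarith
  simp [Matrix.det_succ_row_zero, Fin.sum_univ_succ, Fin.succAbove, s1, s2, s3, s4, s5, u1,
    u2, u3, u4, ← hl]
  linear_combination (r - 1) * (r - (M (0, 1) (0, 1) - M (0, 1) (1, 0))) * (hdet - r * htr)

lemma Jmat_self_comm {χ : ℕ} (hχ : 2 ≤ χ) (x y m : Fin 2) :
    Jmat χ χ (x, y) m = Jmat χ χ (y, x) m := by
  fin_cases x <;> fin_cases y <;> fin_cases m <;> simp [Jmat_self_apply hχ]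

lemma sum_Jmat_self {χ : ℕ} (hχ : 2 ≤ χ) (m : Fin 2) : ∑ x, ∑ y, Jmat χ χ (x, y) m = 1 := by
  have h2 : (χ : ℝ) ^ 2 + 1 ≠ 0 := by positivity
  fin_cases m <;> simp [Jmat_self_apply hχ] <;> field_simp <;> ring

lemma isoOut_comm {χ : ℕ} (hχ : 2 ≤ χ) (w x y z : Fin 2) :
    isoOut χ w x y z = isoOut χ w z y x := by
  rw [isoOut_apply hχ, isoOut_apply hχ, add_right_comm x, add_comm x z, add_right_comm z]
  simp only [and_comm, and_assoc]

lemma sum_isoOut {χ : ℕ} (hχ : 2 ≤ χ) (w : Fin 2) : ∑ x, ∑ y, ∑ z, isoOut χ w x y z = 1 := by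
  have h : (2 : ℝ) ≤ χ := by exact_mod_cast hχ
  have hu : (χ : ℝ) * (χ - 1) + 1 ≠ 0 := by nlinarith
  have hv : (χ : ℝ) * (χ + 1) + 1 ≠ 0 := by positivity
  have h11 : (1 : Fin 2) + 1 = 0 := rfl
  fin_cases w <;> norm_num [isoOut_apply hχ, h11] <;> field_simp <;> ring

lemma sum_isoOut_last {χ : ℕ} (hχ : 2 ≤ χ) (w : Fin 2) :
    ∑ z, ∑ x, ∑ y, isoOut χ w x y z = 1 := by
  rw [Finset.sum_comm, ← sum_isoOut hχ w]
  exact Finset.sum_congr rfl fun x _ => Finset.sum_comm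

lemma EL_swap {χ : ℕ} (hχ : 2 ≤ χ) (x y : Fin 2 × Fin 2) : EL χ x.swap y.swap = ER χ x y := by
  rw [EL_apply, ER_apply, Finset.sum_comm]
  refine Finset.sum_congr rfl fun b _ => Finset.sum_congr rfl fun c _ => ?_
  simp only [Prod.fst_swap, Prod.snd_swap]
  rw [mul_right_comm, add_comm]
  refine congr_arg₂ _ (congr_arg₂ _ ?_ ?_) ?_
  · simp only [Jmat_self_comm hχ x.1]
  · rw [Finset.sum_comm]
    simp only [fun i j => isoOut_comm hχ y.1 b i j]
  · simp only [fun i => isoOut_comm hχ y.2 i x.2 c]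

lemma EC_swap {χ : ℕ} (hχ : 2 ≤ χ) (x y : Fin 2 × Fin 2) : EC χ x.swap y.swap = EC χ x y := by
  rw [EC_apply, EC_apply, Finset.sum_comm]
  refine Finset.sum_congr rfl fun b _ => Finset.sum_congr rfl fun c _ => ?_
  rw [mul_right_comm, add_comm]
  refine congr_arg₂ _ (congr_arg₂ _ ?_ ?_) ?_
  · exact Jmat_self_comm hχ _ _ _
  · simp only [Prod.snd_swap]
    rw [Finset.sum_comm]
    simp only [fun i j => isoOut_comm hχ y.1 b i j]
  · simp only [Prod.fst_swap]
    rw [Finset.sum_comm]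
    simp only [fun i j => isoOut_comm hχ y.2 i j c]

lemma Eavg_apply (χ : ℕ) (x y : Fin 2 × Fin 2) :
    Eavg χ x y = 1 / 3 * (EL χ x y + EC χ x y + ER χ x y) :=
  rfl

lemma Eavg_swap {χ : ℕ} (hχ : 2 ≤ χ) (x y : Fin 2 × Fin 2) :
    Eavg χ x.swap y.swap = Eavg χ x y := by
  have h := EL_swap hχ x.swap y.swap
  simp only [Prod.swap_swap] at h
  rw [Eavg_apply, Eavg_apply, EL_swap hχ, EC_swap hχ, h]
  ring

lemma sum_isoOut_fst {χ : ℕ} (hχ : 2 ≤ χ) (w b : Fin 2) : ∑ i, ∑ j, isoOut χ w i j b =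
    if b = w then ((χ : ℝ) ^ 2 + 1) / (2 * ((χ : ℝ) ^ 2 - (1 - 2 * (w : ℝ)) * χ + 1))
      else ((χ : ℝ) - (1 - 2 * (w : ℝ))) ^ 2 /
        (2 * ((χ : ℝ) ^ 2 - (1 - 2 * (w : ℝ)) * χ + 1)) := by
  have h : (2 : ℝ) ≤ χ := by exact_mod_cast hχ
  have hu : (χ : ℝ) * (χ - 1) + 1 ≠ 0 := by nlinarith
  have hv : (χ : ℝ) * (χ + 1) + 1 ≠ 0 := by positivity
  have h11 : (1 : Fin 2) + 1 = 0 := rfl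
  fin_cases w <;> fin_cases b <;> norm_num [isoOut_apply hχ, h11] <;> field_simp <;> ring

lemma sum_isoOut_snd {χ : ℕ} (hχ : 2 ≤ χ) (w b : Fin 2) : ∑ i, ∑ j, isoOut χ w b i j =
    if b = w then ((χ : ℝ) ^ 2 + 1) / (2 * ((χ : ℝ) ^ 2 - (1 - 2 * (w : ℝ)) * χ + 1))
      else ((χ : ℝ) - (1 - 2 * (w : ℝ))) ^ 2 /
        (2 * ((χ : ℝ) ^ 2 - (1 - 2 * (w : ℝ)) * χ + 1)) := by
  rw [← sum_isoOut_fst hχ, Finset.sum_comm]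
  simp only [fun i j => isoOut_comm hχ w b i j]

lemma sum_mul_mul_eq_one {A K : Fin 2 → Fin 2 → ℝ} {H : Fin 2 → ℝ}
    (hA : ∀ m, ∑ x, A x m = 1) (hH : ∑ b, H b = 1) (hK : ∑ c, ∑ x, K c x = 1) :
    ∑ x, ∑ x', ∑ b, ∑ c, A x (b + c) * H b * K c x' = 1 := by
  simp only [Fin.sum_univ_two] at *
  simp only [fun m => eq_sub_of_add_eq' (hA m), eq_sub_of_add_eq' hH]
  linear_combination hK

lemma sum_ER {χ : ℕ} (hχ : 2 ≤ χ) (y : Fin 2 × Fin 2) : ∑ x, ER χ x y = 1 := by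
  simp only [ER_apply, Fintype.sum_prod_type]
  refine sum_mul_mul_eq_one (A := fun x m => ∑ β, Jmat χ χ (β, x) m)
    (H := fun b => ∑ i, ∑ j, isoOut χ y.1 i j b) (K := fun c x => ∑ k, isoOut χ y.2 c x k)
    (fun m => ?_) (sum_isoOut_last hχ y.1) (sum_isoOut hχ y.2)
  rw [Finset.sum_comm, sum_Jmat_self hχ]

lemma sum_EL {χ : ℕ} (hχ : 2 ≤ χ) (y : Fin 2 × Fin 2) : ∑ x, EL χ x y = 1 := by
  rw [← sum_ER hχ y.swap, ← (Equiv.prodComm (Fin 2) (Fin 2)).sum_comp]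
  simp only [Equiv.prodComm_apply, ← EL_swap hχ _ y.swap, Prod.swap_swap]

lemma sum_EC {χ : ℕ} (hχ : 2 ≤ χ) (y : Fin 2 × Fin 2) : ∑ x, EC χ x y = 1 := by
  simp only [EC_apply]
  rw [Finset.sum_comm, ← sum_isoOut_last hχ y.1]
  refine Finset.sum_congr rfl fun b _ => ?_
  rw [Finset.sum_comm]
  simp only [← Finset.sum_mul, Fintype.sum_prod_type, sum_Jmat_self hχ, one_mul,
    ← Finset.mul_sum, sum_isoOut hχ, mul_one]

lemma sum_Eavg {χ : ℕ} (hχ : 2 ≤ χ) (y : Fin 2 × Fin 2) : ∑ x, Eavg χ x y = 1 := by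
  simp only [Eavg_apply, ← Finset.mul_sum, Finset.sum_add_distrib, sum_EL hχ, sum_EC hχ,
    sum_ER hχ]
  norm_num

lemma sq_sqrt_discrim (χ : ℕ) :
    √(1 + 4 * (χ : ℝ) ^ 2 + 54 * (χ : ℝ) ^ 4 + 4 * (χ : ℝ) ^ 6 + (χ : ℝ) ^ 8) ^ 2 =
      1 + 4 * (χ : ℝ) ^ 2 + 54 * (χ : ℝ) ^ 4 + 4 * (χ : ℝ) ^ 6 + (χ : ℝ) ^ 8 :=
  Real.sq_sqrt (by positivity)

lemma etaTer_add_lam4Ter (χ : ℕ) : etaTer χ + lam4Ter χ =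
    (χ : ℝ) ^ 2 * (1 + 8 * (χ : ℝ) ^ 2 + (χ : ℝ) ^ 4) /
      (3 * (1 + (χ : ℝ) ^ 2 + (χ : ℝ) ^ 4) ^ 2) := by
  rw [etaTer, lam4Ter]
  field_simp
  ring

lemma etaTer_mul_lam4Ter (χ : ℕ) : etaTer χ * lam4Ter χ =
    (χ : ℝ) ^ 6 / (3 * (1 + (χ : ℝ) ^ 2 + (χ : ℝ) ^ 4) ^ 3) := by
  rw [etaTer, lam4Ter, div_mul_div_comm, div_eq_div_iff (by positivity) (by positivity)]
  linear_combination -(χ : ℝ) ^ 4 * (3 * (1 + (χ : ℝ) ^ 2 + (χ : ℝ) ^ 4) ^ 3) * sq_sqrt_discrim χ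

lemma etaTer_lt_one (χ : ℕ) : etaTer χ < 1 := by
  have hs : √(1 + 4 * (χ : ℝ) ^ 2 + 54 * (χ : ℝ) ^ 4 + 4 * (χ : ℝ) ^ 6 + (χ : ℝ) ^ 8) ≤
      1 + 8 * (χ : ℝ) ^ 2 + (χ : ℝ) ^ 4 := by
    refine Real.sqrt_le_iff.2 ⟨by positivity, ?_⟩
    have : 0 ≤ 12 * (χ : ℝ) ^ 2 + 12 * (χ : ℝ) ^ 4 + 12 * (χ : ℝ) ^ 6 := by positivity
    linear_combination this
  rw [etaTer, div_lt_one (by positivity)]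
  have h := mul_le_mul_of_nonneg_left hs (sq_nonneg (χ : ℝ))
  have : 0 < 6 + 10 * (χ : ℝ) ^ 2 + 2 * (χ : ℝ) ^ 4 + 10 * (χ : ℝ) ^ 6 + 6 * (χ : ℝ) ^ 8 := by
    positivity
  linear_combination h + this

lemma lam3Ter_lt_etaTer {χ : ℕ} (hχ : 0 < χ) : lam3Ter χ < etaTer χ := by
  have hs : 1 - 6 * (χ : ℝ) ^ 2 + (χ : ℝ) ^ 4 <
      √(1 + 4 * (χ : ℝ) ^ 2 + 54 * (χ : ℝ) ^ 4 + 4 * (χ : ℝ) ^ 6 + (χ : ℝ) ^ 8) := by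
    refine Real.lt_sqrt_of_sq_lt ?_
    have : 0 < 16 * (χ : ℝ) ^ 2 + 16 * (χ : ℝ) ^ 4 + 16 * (χ : ℝ) ^ 6 := by positivity
    linear_combination this
  rw [lam3Ter, etaTer, div_lt_div_iff₀ (by positivity) (by positivity)]
  have hp : 0 < 3 * (χ : ℝ) ^ 2 * (1 + (χ : ℝ) ^ 2 + (χ : ℝ) ^ 4) := by positivity
  linear_combination mul_lt_mul_of_pos_left hs hp

lemma lam4Ter_lt_etaTer {χ : ℕ} (hχ : 0 < χ) : lam4Ter χ < etaTer χ := by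
  have hs : 0 < √(1 + 4 * (χ : ℝ) ^ 2 + 54 * (χ : ℝ) ^ 4 + 4 * (χ : ℝ) ^ 6 + (χ : ℝ) ^ 8) := by
    positivity
  rw [lam4Ter, etaTer]
  gcongr
  linarith

set_option maxHeartbeats 1000000 in
/-- The spatially averaged doubled layer-transition channel `E = (E_L + E_C + E_R)/3` of the
ternary 1D MERA has eigenvalues (with multiplicity) `1, η_ter, λ₃, λ₄`; in particular the
unique largest eigenvalue is `1` and the second largest is `η_ter`. -/
theorem charpoly_Eavg_ternary (χ : ℕ) (hχ : 2 ≤ χ) :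
    (Eavg χ).charpoly
        = (X - C 1) * (X - C (etaTer χ)) * (X - C (lam3Ter χ)) * (X - C (lam4Ter χ))
      ∧ etaTer χ < 1 ∧ lam3Ter χ < etaTer χ ∧ lam4Ter χ < etaTer χ := by
  have h : (2 : ℝ) ≤ χ := by exact_mod_cast hχ
  have hu : (χ : ℝ) * (χ - 1) + 1 ≠ 0 := by nlinarith
  have hv : (χ : ℝ) * (χ + 1) + 1 ≠ 0 := by positivity
  have hw : 1 + (χ : ℝ) ^ 2 + χ ^ 4 ≠ 0 := by positivity
  have h11 : (1 : Fin 2) + 1 = 0 := rfl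
  refine ⟨charpoly_of_swap_of_sum (Eavg_swap hχ) (sum_Eavg hχ) ?_ ?_ ?_, etaTer_lt_one χ,
    lam3Ter_lt_etaTer (by lia), lam4Ter_lt_etaTer (by lia)⟩
  · rw [lam3Ter]
    norm_num [Eavg_apply, EL_apply, EC_apply, ER_apply, sum_isoOut_fst hχ, sum_isoOut_snd hχ,
      isoOut_apply hχ, Jmat_self_apply hχ, h11]
    field_simp
    ring
  · rw [etaTer_add_lam4Ter]
    norm_num [Eavg_apply, EL_apply, EC_apply, ER_apply, sum_isoOut_fst hχ, sum_isoOut_snd hχ,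
      isoOut_apply hχ, Jmat_self_apply hχ, h11]
    field_simp
    ring
  · rw [etaTer_mul_lam4Ter]
    norm_num [Eavg_apply, EL_apply, EC_apply, ER_apply, sum_isoOut_fst hχ, sum_isoOut_snd hχ,
      isoOut_apply hχ, Jmat_self_apply hχ, h11]
    field_simp
    ring

end MERAter
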